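/- Let P be a general program and M ⊆ σ_P a set of atoms. Then P ∪ ¬M̃ ⊩_I M if and only if P ∪ ¬M̃ ∪ ¬¬M ⊩_I M. -/

import Mathlib

namespace ASP

/-- Propositional formulas over atoms `α`, built with ∧, ∨, ← and ⊥.
`impl A B` denotes the formula `B ← A` (i.e. `A → B`). -/
inductive PropForm (α : Type) : Type
  | var : α → PropForm α
  | fals : PropForm α
  | conj : PropForm α → PropForm α → PropForm α
  | disj : PropForm α → PropForm α → PropForm α
  | impl : PropForm α → PropForm α → PropForm α
  deriving DecidableEq

namespace PropForm

variable {α : Type}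

/-- `¬F` abbreviates `⊥ ← F`. -/
def neg (A : PropForm α) : PropForm α := impl A fals

/-- `⊤` abbreviates `⊥ ← ⊥`. -/
def top : PropForm α := impl fals fals

/-- The set of atoms occurring in a formula. -/
def atoms : PropForm α → Set α
  | var a => {a}
  | fals => ∅
  | conj A B => atoms A ∪ atoms B
  | disj A B => atoms A ∪ atoms B
  | impl A B => atoms A ∪ atoms B

end PropForm

open PropForm

/-- Hilbert-style derivability for intuitionistic propositional logic,
with an extra set `Ax` of additional axioms. -/
inductive Deriv {α : Type} (Ax : Set (PropForm α)) : PropForm α → Prop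
  | ax {A} : A ∈ Ax → Deriv Ax A
  | k (A B) : Deriv Ax (impl A (impl B A))
  | s (A B C) : Deriv Ax (impl (impl A (impl B C)) (impl (impl A B) (impl A C)))
  | conjIntro (A B) : Deriv Ax (impl A (impl B (conj A B)))
  | conjElimL (A B) : Deriv Ax (impl (conj A B) A)
  | conjElimR (A B) : Deriv Ax (impl (conj A B) B)
  | disjIntroL (A B) : Deriv Ax (impl A (disj A B))
  | disjIntroR (A B) : Deriv Ax (impl B (disj A B))
  | disjElim (A B C) : Deriv Ax (impl (impl A C) (impl (impl B C) (impl (disj A B) C)))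
  | falsElim (A) : Deriv Ax (impl fals A)
  | mp {A B} : Deriv Ax (impl A B) → Deriv Ax A → Deriv Ax B

/-- `F` is a theorem of intuitionistic propositional logic. -/
def IThm {α : Type} (F : PropForm α) : Prop := Deriv ∅ F

/-- `F` is a theorem of classical propositional logic
(intuitionistic logic plus double-negation elimination). -/
def CThm {α : Type} (F : PropForm α) : Prop :=
  Deriv {F | ∃ A, F = impl (neg (neg A)) A} F

/-- Conjunction of a finite list of formulas (empty conjunction is ⊤). -/
def bigConj {α : Type} : List (PropForm α) → PropForm α
  | [] => top
  | [A] => A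
  | A :: L => conj A (bigConj L)

/-- Disjunction of a finite list of formulas (empty disjunction is ⊥). -/
def bigDisj {α : Type} : List (PropForm α) → PropForm α
  | [] => fals
  | [A] => A
  | A :: L => disj A (bigDisj L)

/-- `T ⊢_X F`: the formula `F ← (F₁ ∧ ... ∧ Fₙ)` is a theorem of the logic
whose theorems are `Thm`, for some `F₁, ..., Fₙ ∈ T`. -/
def ProvesFrom {α : Type} (Thm : PropForm α → Prop) (T : Set (PropForm α))
    (F : PropForm α) : Prop :=
  ∃ L : List (PropForm α), (∀ G ∈ L, G ∈ T) ∧ Thm (impl (bigConj L) F)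

/-- `T ⊢_I F`. -/
def IProves {α : Type} (T : Set (PropForm α)) (F : PropForm α) : Prop :=
  ProvesFrom IThm T F

/-- `T ⊢_C F`. -/
def CProves {α : Type} (T : Set (PropForm α)) (F : PropForm α) : Prop :=
  ProvesFrom CThm T F

/-- `T` is consistent in intuitionistic logic. -/
def IConsistent {α : Type} (T : Set (PropForm α)) : Prop := ¬ IProves T fals

/-- `T ⊩_I M`: `T` is consistent and proves (intuitionistically) every atom of `M`. -/
def IProvesAll {α : Type} (T : Set (PropForm α)) (M : Set α) : Prop :=
  IConsistent T ∧ ∀ a ∈ M, IProves T (var a)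

/-- `T ≡_I U`: the two theories prove each other's formulas intuitionistically. -/
def IEquivTh {α : Type} (T U : Set (PropForm α)) : Prop :=
  (∀ F ∈ U, IProves T F) ∧ (∀ F ∈ T, IProves U F)

/-- The signature (set of occurring atoms) of a theory. -/
def sigTh {α : Type} (T : Set (PropForm α)) : Set α := ⋃ F ∈ T, F.atoms

/-- `T` is (literal) complete: for every atom `a` of its signature,
`T ⊢_I a` or `T ⊢_I ¬a`. -/
def IComplete {α : Type} (T : Set (PropForm α)) : Prop :=
  ∀ a ∈ sigTh T, IProves T (var a) ∨ IProves T (neg (var a))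

/-- `{¬a : a ∈ S}`. -/
def negSet {α : Type} (S : Set α) : Set (PropForm α) := (fun a => neg (var a)) '' S

/-- `{¬¬a : a ∈ S}`. -/
def negnegSet {α : Type} (S : Set α) : Set (PropForm α) :=
  (fun a => neg (neg (var a))) '' S

/-- Classical two-valued satisfaction, identifying an interpretation with the
set of atoms it makes true. -/
def sat2 {α : Type} (X : Set α) : PropForm α → Prop
  | .var a => a ∈ X
  | .fals => False
  | .conj A B => sat2 X A ∧ sat2 X B
  | .disj A B => sat2 X A ∨ sat2 X B
  | .impl A B => sat2 X A → sat2 X B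

/-- `X` is a classical model of the theory `T`. -/
def isModel2 {α : Type} (X : Set α) (T : Set (PropForm α)) : Prop := ∀ F ∈ T, sat2 X F

/-- `M` is a minimal (under ⊆) classical model of `T`. -/
def isMinModel {α : Type} (T : Set (PropForm α)) (M : Set α) : Prop :=
  isModel2 M T ∧ ∀ N ⊆ M, isModel2 N T → N = M

/-- Evaluation in the 3-valued Gödel logic G3. -/
def g3 {α : Type} (I : α → Fin 3) : PropForm α → Fin 3
  | .var a => I a
  | .fals => 0
  | .conj A B => min (g3 I A) (g3 I B)
  | .disj A B => max (g3 I A) (g3 I B)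
  | .impl A B => if g3 I A ≤ g3 I B then 2 else g3 I B

/-- Nested formulas: built from atoms, ⊤ and ⊥ using ∧, ∨ and ¬. -/
inductive NF (α : Type) : Type
  | var : α → NF α
  | top : NF α
  | bot : NF α
  | conj : NF α → NF α → NF α
  | disj : NF α → NF α → NF α
  | neg : NF α → NF α
  deriving DecidableEq

namespace NF

variable {α : Type}

/-- Reading a nested formula as a propositional formula
(`⊤ = ⊥ ← ⊥` and `¬F = ⊥ ← F`). -/
def toProp : NF α → PropForm α
  | var a => .var a
  | top => PropForm.top
  | bot => .fals
  | conj A B => .conj (toProp A) (toProp B)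
  | disj A B => .disj (toProp A) (toProp B)
  | neg A => PropForm.neg (toProp A)

/-- Atoms occurring in a nested formula. -/
def atoms : NF α → Set α
  | var a => {a}
  | top => ∅
  | bot => ∅
  | conj A B => atoms A ∪ atoms B
  | disj A B => atoms A ∪ atoms B
  | neg A => atoms A

/-- Satisfaction of a (basic, negation-free) nested formula by a set of atoms. -/
def satB (X : Set α) : NF α → Prop
  | var a => a ∈ X
  | top => True
  | bot => False
  | conj A B => satB X A ∧ satB X B
  | disj A B => satB X A ∨ satB X B
  | neg A => ¬ satB X A

open scoped Classical in
/-- The reduct `F^X`: each maximal subformula `¬G` is replaced by ⊥ if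
`X ⊨ G^X` and by ⊤ otherwise. -/
noncomputable def reduct (X : Set α) : NF α → NF α
  | var a => var a
  | top => top
  | bot => bot
  | conj A B => conj (reduct X A) (reduct X B)
  | disj A B => disj (reduct X A) (reduct X B)
  | neg A => if satB X (reduct X A) then bot else top

end NF

/-- An augmented clause `H ← B` is a pair `(H, B)` of nested formulas. -/
abbrev AugClause (α : Type) := NF α × NF α

/-- The propositional formula `H ← B` of an augmented clause. -/
def clauseToProp {α : Type} (c : AugClause α) : PropForm α :=
  .impl c.2.toProp c.1.toProp

/-- The theory of an augmented program. -/
def progTh {α : Type} (P : List (AugClause α)) : Set (PropForm α) :=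
  {F | ∃ c ∈ P, clauseToProp c = F}

/-- The signature of an augmented program. -/
def progSig {α : Type} (P : List (AugClause α)) : Set α :=
  {a | ∃ c ∈ P, a ∈ c.1.atoms ∪ c.2.atoms}

/-- `X` is closed under the (basic) program `P`: for each clause `H ← B`,
`X ⊨ H` whenever `X ⊨ B`. -/
def closedUnder {α : Type} (X : Set α) (P : List (AugClause α)) : Prop :=
  ∀ c ∈ P, NF.satB X c.2 → NF.satB X c.1

/-- The reduct `P^X` of an augmented program. -/
noncomputable def progReduct {α : Type} (X : Set α) (P : List (AugClause α)) :
    List (AugClause α) :=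
  P.map fun c => (c.1.reduct X, c.2.reduct X)

/-- `M` is an answer set of `P`: `M` is minimal (under ⊆) among the sets of
atoms closed under the reduct `P^M`. -/
def isAnswerSet {α : Type} (P : List (AugClause α)) (M : Set α) : Prop :=
  closedUnder M (progReduct M P) ∧ ∀ N ⊆ M, closedUnder N (progReduct M P) → N = M

/-- `M` is a min-answer set of `P`: both an answer set and a minimal model. -/
def isMinAnswerSet {α : Type} (P : List (AugClause α)) (M : Set α) : Prop :=
  isAnswerSet P M ∧ isMinModel (progTh P) M

/-- A G3 interpretation models an augmented program. -/
def g3ModelsProg {α : Type} (I : α → Fin 3) (P : List (AugClause α)) : Prop :=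
  ∀ c ∈ P, g3 I (clauseToProp c) = 2

/-- A free clause: a list of head literals and a list of body literals,
a literal being an atom `(a, true)` or a negated atom `(a, false)`.
It denotes `h₁ ∨ ... ∨ hₙ ← b₁ ∧ ... ∧ bₘ` (empty head = ⊥, empty body = ⊤). -/
structure FClause (α : Type) where
  head : List (α × Bool)
  body : List (α × Bool)
  deriving DecidableEq

/-- The propositional formula of a literal. -/
def litToProp {α : Type} : α × Bool → PropForm α
  | (a, true) => .var a
  | (a, false) => PropForm.neg (.var a)

/-- The nested formula of a literal. -/
def litToNF {α : Type} : α × Bool → NF α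
  | (a, true) => .var a
  | (a, false) => .neg (.var a)

/-- Disjunction of a list of nested formulas (empty = ⊥). -/
def bigDisjNF {α : Type} : List (NF α) → NF α
  | [] => .bot
  | [A] => A
  | A :: L => .disj A (bigDisjNF L)

/-- Conjunction of a list of nested formulas (empty = ⊤). -/
def bigConjNF {α : Type} : List (NF α) → NF α
  | [] => .top
  | [A] => A
  | A :: L => .conj A (bigConjNF L)

namespace FClause

variable {α : Type}

/-- The propositional formula of a free clause. -/
def toProp (c : FClause α) : PropForm α :=
  .impl (bigConj (c.body.map litToProp)) (bigDisj (c.head.map litToProp))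

/-- A free clause as an augmented clause. -/
def toAug (c : FClause α) : AugClause α :=
  (bigDisjNF (c.head.map litToNF), bigConjNF (c.body.map litToNF))

/-- The atoms of a free clause. -/
def atomsF (c : FClause α) : Set α :=
  {a | (∃ b, (a, b) ∈ c.head) ∨ (∃ b, (a, b) ∈ c.body)}

/-- A general clause: all head literals are positive atoms. -/
def isGeneral (c : FClause α) : Prop := ∀ l ∈ c.head, l.2 = true

/-- A disjunctive clause: a general clause with nonempty head. -/
def isDisjunctive (c : FClause α) : Prop := c.isGeneral ∧ c.head ≠ []

/-- A constraint: a clause with empty head (head ⊥). -/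
def isConstraint (c : FClause α) : Prop := c.head = []

end FClause

/-- The theory of a free program. -/
def fTh {α : Type} (P : List (FClause α)) : Set (PropForm α) :=
  {F | ∃ c ∈ P, c.toProp = F}

/-- The signature of a free program. -/
def fSig {α : Type} (P : List (FClause α)) : Set α :=
  {a | ∃ c ∈ P, a ∈ c.atomsF}

/-- `GenDisj(P)`: each constraint `⊥ ← B` is replaced by `p ← B ∧ ¬p`,
where `p` is a new reserved atom. -/
def genDisj {α : Type} [DecidableEq α] (P : List (FClause α)) (p : α) :
    List (FClause α) :=
  P.map fun c =>
    if c.head = [] then ⟨[(p, true)], c.body ++ [(p, false)]⟩ else c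

/-- The atoms `a` such that `¬a` occurs in the head of some clause of `P`
(the set `S` of the FreeGen transformation), as a list. -/
def headNegs {α : Type} (P : List (FClause α)) : List α :=
  P.flatMap fun c => c.head.filterMap fun l => if l.2 = false then some l.1 else none

open scoped Classical in
/-- Replace the occurrence of `¬a` (for `a ∈ S`) by the positive atom `φ a`. -/
noncomputable def substLit {α : Type} (S : Set α) (φ : α → α) (l : α × Bool) :
    α × Bool :=
  if l.2 = false ∧ l.1 ∈ S then (φ l.1, true) else l

/-- Replace every occurrence of `¬a` (for `a ∈ S`) by `φ a` in a clause. -/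
noncomputable def FClause.subst {α : Type} (S : Set α) (φ : α → α) (c : FClause α) :
    FClause α :=
  ⟨c.head.map (substLit S φ), c.body.map (substLit S φ)⟩

/-- `Δ_S = ⋃_{a ∈ S} {φ(a) ← ¬a, ⊥ ← a ∧ φ(a)}`. -/
def deltaClauses {α : Type} (L : List α) (φ : α → α) : List (FClause α) :=
  L.flatMap fun a => [⟨[(φ a, true)], [(a, false)]⟩, ⟨[], [(a, true), (φ a, true)]⟩]

/-- `FreeGen(P) = P' ∪ Δ_S`. -/
noncomputable def freeGen {α : Type} (P : List (FClause α)) (φ : α → α) :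
    List (FClause α) :=
  P.map (FClause.subst {a | a ∈ headNegs P} φ) ++ deltaClauses (headNegs P) φ

open scoped Classical in
/-- The second reduction `redu2(P; ¬¬M)`: clauses whose body contains a literal
`¬a` with `a ∈ M` are deleted; in constraints, positive body literals `a ∈ M`
are deleted. -/
noncomputable def redu2 {α : Type} [DecidableEq α] (P : List (FClause α))
    (M : Set α) : List (FClause α) :=
  (P.filter fun c => decide (¬ ∃ l ∈ c.body, l.2 = false ∧ l.1 ∈ M)).map
    fun c =>
      if c.head = [] then
        ⟨[], c.body.filter fun l => decide (¬ (l.2 = true ∧ l.1 ∈ M))⟩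
      else c

/-- `P₂` is a conservative extension of `P₁`: `M₁` is an answer set of `P₁`
iff `M₂` is an answer set of `P₂`, where `M₁ = M₂ ∩ σ_{P₁}`. -/
def consExt {α : Type} (P1 P2 : List (AugClause α)) : Prop :=
  (∀ M2 : Set α, isAnswerSet P2 M2 → isAnswerSet P1 (M2 ∩ progSig P1)) ∧
  (∀ M1 : Set α, isAnswerSet P1 M1 →
    ∃ M2 : Set α, isAnswerSet P2 M2 ∧ M1 = M2 ∩ progSig P1)

/-- `P₂` is a strong conservative extension of the user program `P₁` (relative
to the user signature `U`): for every user program `P`, `P₂ ∪ P` is a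
conservative extension of `P₁ ∪ P`. -/
def strongConsExt {α : Type} (P1 P2 : List (AugClause α)) (U : Set α) : Prop :=
  ∀ P : List (AugClause α), progSig P ⊆ U → consExt (P1 ++ P) (P2 ++ P)

mutual
  /-- Negation normal form: push negations inward (no pending negation). -/
  def nnf0 {α : Type} : NF α → NF α
    | .var a => .var a
    | .top => .top
    | .bot => .bot
    | .conj A B => .conj (nnf0 A) (nnf0 B)
    | .disj A B => .disj (nnf0 A) (nnf0 B)
    | .neg A => nnf1 A
  /-- Negation normal form under one pending negation. -/
  def nnf1 {α : Type} : NF α → NF α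
    | .var a => .neg (.var a)
    | .top => .bot
    | .bot => .top
    | .conj A B => .disj (nnf1 A) (nnf1 B)
    | .disj A B => .conj (nnf1 A) (nnf1 B)
    | .neg A => nnf2 A
  /-- Negation normal form under two pending negations. -/
  def nnf2 {α : Type} : NF α → NF α
    | .var a => .neg (.neg (.var a))
    | .top => .top
    | .bot => .bot
    | .conj A B => .conj (nnf2 A) (nnf2 B)
    | .disj A B => .disj (nnf2 A) (nnf2 B)
    | .neg A => nnf1 A
end

/-- Conjunctive normal form (list of disjunction-lists of leaves). -/
def cnfNF {α : Type} : NF α → List (List (NF α))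
  | .conj A B => cnfNF A ++ cnfNF B
  | .disj A B => (cnfNF A).flatMap fun c => (cnfNF B).map fun d => c ++ d
  | F => [[F]]

/-- Disjunctive normal form (list of conjunction-lists of leaves). -/
def dnfNF {α : Type} : NF α → List (List (NF α))
  | .disj A B => dnfNF A ++ dnfNF B
  | .conj A B => (dnfNF A).flatMap fun c => (dnfNF B).map fun d => c ++ d
  | F => [[F]]

/-- Read a leaf as a literal (if it is one). -/
def leafLit {α : Type} : NF α → Option (α × Bool)
  | .var a => some (a, true)
  | .neg (.var a) => some (a, false)
  | _ => none

/-- Read a leaf `¬¬a` as the literal `¬a` to be moved to the other side. -/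
def dnegLit {α : Type} : NF α → Option (α × Bool)
  | .neg (.neg (.var a)) => some (a, false)
  | _ => none

/-- Build a free clause from a head disjunct-list and a body conjunct-list:
doubly negated atoms `¬¬a` in the head become `¬a` in the body and vice versa;
trivial clauses (⊤ in the head or ⊥ in the body) are removed. -/
def procClause {α : Type} [DecidableEq α] (hd bd : List (NF α)) :
    Option (FClause α) :=
  if NF.top ∈ hd ∨ NF.bot ∈ bd then none
  else some ⟨hd.filterMap leafLit ++ bd.filterMap dnegLit,
             bd.filterMap leafLit ++ hd.filterMap dnegLit⟩

/-- `AugFree(P)`: the free program obtained from the augmented program `P` by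
pushing negations inward, taking CNF of heads and DNF of bodies, splitting
conjunctions in heads and disjunctions in bodies into separate clauses, and
eliminating doubly negated atoms. -/
def augFree {α : Type} [DecidableEq α] (P : List (AugClause α)) :
    List (FClause α) :=
  P.flatMap fun c =>
    (cnfNF (nnf0 c.1)).flatMap fun hd =>
      (dnfNF (nnf0 c.2)).filterMap fun bd => procClause hd bd

/-- Positive formulas: no negation (in particular no ⊥) occurs. -/
def IsPositive {α : Type} : PropForm α → Prop
  | .var _ => True
  | .fals => False
  | .conj A B => IsPositive A ∧ IsPositive B
  | .disj A B => IsPositive A ∧ IsPositive B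
  | .impl A B => IsPositive A ∧ IsPositive B

/-- The set 𝐍 of two-negated formulas. -/
inductive IsTwoNeg {α : Type} : PropForm α → Prop
  | atom (a : α) : IsTwoNeg (neg (neg (var a)))
  | dneg {A} : IsTwoNeg A → IsTwoNeg (neg (neg A))
  | conj {A B} : IsTwoNeg A → IsTwoNeg B → IsTwoNeg (PropForm.conj A B)
  | disjL {A} (B) : IsTwoNeg A → IsTwoNeg (PropForm.disj A B)
  | disjR {A} (B) : IsTwoNeg A → IsTwoNeg (PropForm.disj B A)
  | himp {A} (B) : IsTwoNeg A → IsTwoNeg (PropForm.impl B A)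

/-- Implication of the three-valued Gödel logic. -/
def g3Impl (a b : Fin 3) : Fin 3 := if a ≤ b then 2 else b

theorem g3_impl {α : Type} (I : α → Fin 3) (A B : PropForm α) :
    g3 I (impl A B) = g3Impl (g3 I A) (g3 I B) := rfl

theorem g3_conj {α : Type} (I : α → Fin 3) (A B : PropForm α) :
    g3 I (conj A B) = min (g3 I A) (g3 I B) := rfl

theorem g3_disj {α : Type} (I : α → Fin 3) (A B : PropForm α) :
    g3 I (disj A B) = max (g3 I A) (g3 I B) := rfl

namespace Deriv

variable {α : Type} {T U : Set (PropForm α)} {A B C F G : PropForm α}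

theorem cut (h : Deriv T F) (hTU : ∀ G ∈ T, Deriv U G) : Deriv U F := by
  induction h with
  | ax h => exact hTU _ h
  | k A B => exact k A B
  | s A B C => exact s A B C
  | conjIntro A B => exact conjIntro A B
  | conjElimL A B => exact conjElimL A B
  | conjElimR A B => exact conjElimR A B
  | disjIntroL A B => exact disjIntroL A B
  | disjIntroR A B => exact disjIntroR A B
  | disjElim A B C => exact disjElim A B C
  | falsElim A => exact falsElim A
  | mp _ _ ih₁ ih₂ => exact mp ih₁ ih₂

theorem mono (hTU : T ⊆ U) (h : Deriv T F) : Deriv U F :=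
  h.cut fun _ hG => ax (hTU hG)

/-- Every derivation uses a finite list of axioms. -/
theorem exists_list (h : Deriv T F) :
    ∃ L : List (PropForm α), (∀ G ∈ L, G ∈ T) ∧ Deriv {G | G ∈ L} F := by
  induction h with
  | @ax A h => exact ⟨[A], by simpa using h, ax (by simp)⟩
  | k A B => exact ⟨[], by simp, k A B⟩
  | s A B C => exact ⟨[], by simp, s A B C⟩
  | conjIntro A B => exact ⟨[], by simp, conjIntro A B⟩
  | conjElimL A B => exact ⟨[], by simp, conjElimL A B⟩
  | conjElimR A B => exact ⟨[], by simp, conjElimR A B⟩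
  | disjIntroL A B => exact ⟨[], by simp, disjIntroL A B⟩
  | disjIntroR A B => exact ⟨[], by simp, disjIntroR A B⟩
  | disjElim A B C => exact ⟨[], by simp, disjElim A B C⟩
  | falsElim A => exact ⟨[], by simp, falsElim A⟩
  | mp _ _ ih₁ ih₂ =>
    obtain ⟨L₁, hL₁, h₁⟩ := ih₁
    obtain ⟨L₂, hL₂, h₂⟩ := ih₂
    refine ⟨L₁ ++ L₂, fun G hG => ?_, mp (h₁.mono ?_) (h₂.mono ?_)⟩
    · exact (List.mem_append.1 hG).elim (hL₁ G) (hL₂ G)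
    · exact fun G hG => List.mem_append_left _ hG
    · exact fun G hG => List.mem_append_right _ hG

theorem impl_self (A : PropForm α) : Deriv T (impl A A) :=
  mp (mp (s A (impl A A) A) (k A _)) (k A A)

/-- The deduction theorem. -/
theorem deduction (h : Deriv (insert A T) F) : Deriv T (impl A F) := by
  induction h with
  | ax h =>
    rcases h with rfl | h
    · exact impl_self _
    · exact mp (k _ _) (ax h)
  | k B C => exact mp (k _ _) (k B C)
  | s B C D => exact mp (k _ _) (s B C D)
  | conjIntro B C => exact mp (k _ _) (conjIntro B C)
  | conjElimL B C => exact mp (k _ _) (conjElimL B C)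
  | conjElimR B C => exact mp (k _ _) (conjElimR B C)
  | disjIntroL B C => exact mp (k _ _) (disjIntroL B C)
  | disjIntroR B C => exact mp (k _ _) (disjIntroR B C)
  | disjElim B C D => exact mp (k _ _) (disjElim B C D)
  | falsElim B => exact mp (k _ _) (falsElim B)
  | mp _ _ ih₁ ih₂ => exact mp (mp (s _ _ _) ih₁) ih₂

theorem bigConj_iff : ∀ {L : List (PropForm α)},
    Deriv T (bigConj L) ↔ ∀ G ∈ L, Deriv T G
  | [] => ⟨fun _ _ hG => (List.not_mem_nil hG).elim, fun _ => impl_self fals⟩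
  | [A] => by simp [bigConj]
  | A :: B :: L => by
    rw [List.forall_mem_cons, ← bigConj_iff (L := B :: L)]
    exact ⟨fun h => ⟨mp (conjElimL _ _) h, mp (conjElimR _ _) h⟩,
      fun h => mp (mp (conjIntro _ _) h.1) h.2⟩

/-- Derivations are sound for the three-valued Gödel logic. -/
theorem g3_eq_two (h : Deriv T F) {I : α → Fin 3} (hI : ∀ G ∈ T, g3 I G = 2) :
    g3 I F = 2 := by
  induction h with
  | ax h => exact hI _ h
  | k A B =>
    simp only [g3_impl]
    generalize g3 I A = a, g3 I B = b
    revert a b; decide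
  | s A B C =>
    simp only [g3_impl]
    generalize g3 I A = a, g3 I B = b, g3 I C = c
    revert a b c; decide
  | conjIntro A B =>
    simp only [g3_impl, g3_conj]
    generalize g3 I A = a, g3 I B = b
    revert a b; decide
  | conjElimL A B => simp [g3]
  | conjElimR A B => simp [g3]
  | disjIntroL A B => simp [g3]
  | disjIntroR A B => simp [g3]
  | disjElim A B C =>
    simp only [g3_impl, g3_disj]
    generalize g3 I A = a, g3 I B = b, g3 I C = c
    revert a b c; decide
  | falsElim A => simp [g3]
  | @mp A B _ _ ih₁ ih₂ =>
    simp only [g3, ih₂] at ih₁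
    generalize g3 I B = b at ih₁ ⊢
    revert b; decide

theorem exists_of_isChain {c : Set (Set (PropForm α))} (hc : IsChain (· ⊆ ·) c)
    (hne : c.Nonempty) (h : Deriv (⋃₀ c) F) : ∃ t ∈ c, Deriv t F := by
  obtain ⟨t₀, ht₀⟩ := hne
  induction h with
  | ax h =>
    obtain ⟨t, ht, hA⟩ := h
    exact ⟨t, ht, ax hA⟩
  | k A B => exact ⟨t₀, ht₀, k A B⟩
  | s A B C => exact ⟨t₀, ht₀, s A B C⟩
  | conjIntro A B => exact ⟨t₀, ht₀, conjIntro A B⟩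
  | conjElimL A B => exact ⟨t₀, ht₀, conjElimL A B⟩
  | conjElimR A B => exact ⟨t₀, ht₀, conjElimR A B⟩
  | disjIntroL A B => exact ⟨t₀, ht₀, disjIntroL A B⟩
  | disjIntroR A B => exact ⟨t₀, ht₀, disjIntroR A B⟩
  | disjElim A B C => exact ⟨t₀, ht₀, disjElim A B C⟩
  | falsElim A => exact ⟨t₀, ht₀, falsElim A⟩
  | mp _ _ ih₁ ih₂ =>
    obtain ⟨t₁, ht₁, h₁⟩ := ih₁
    obtain ⟨t₂, ht₂, h₂⟩ := ih₂
    rcases hc.total ht₁ ht₂ with h | h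
    · exact ⟨t₂, ht₂, mp (h₁.mono h) h₂⟩
    · exact ⟨t₁, ht₁, mp h₁ (h₂.mono h)⟩

end Deriv

theorem iProves_iff_deriv {α : Type} {T : Set (PropForm α)} {F : PropForm α} :
    IProves T F ↔ Deriv T F := by
  constructor
  · rintro ⟨L, hL, h⟩
    exact (h.mono (Set.empty_subset _)).mp (Deriv.bigConj_iff.2 fun G hG => .ax (hL G hG))
  · intro h
    obtain ⟨L, hL, h⟩ := h.exists_list
    exact ⟨L, hL, Deriv.deduction (h.cut (Deriv.bigConj_iff.1 (.ax (Set.mem_insert _ _))))⟩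

/-- `Γ` is maximal among the theories that do not derive `G`. -/
def IsMaxAvoiding {α : Type} (G : PropForm α) (Γ : Set (PropForm α)) : Prop :=
  ¬ Deriv Γ G ∧ ∀ F, ¬ Deriv Γ F → Deriv Γ (impl F G)

theorem exists_isMaxAvoiding {α : Type} {T : Set (PropForm α)} {G : PropForm α}
    (h : ¬ Deriv T G) : ∃ Γ, T ⊆ Γ ∧ IsMaxAvoiding G Γ := by
  obtain ⟨Γ, hT, hΓ⟩ := zorn_subset_nonempty {Γ | ¬ Deriv Γ G}
    (fun c hcS hc hne => ⟨⋃₀ c, fun hd => by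
      obtain ⟨t, ht, h⟩ := hd.exists_of_isChain hc hne
      exact hcS ht h, fun s hs => Set.subset_sUnion_of_mem hs⟩) T h
  refine ⟨Γ, hT, hΓ.prop, fun F hF => by_contra fun hFG => hF ?_⟩
  have hins : insert F Γ ∈ {Γ | ¬ Deriv Γ G} := fun hd => hFG hd.deduction
  exact .ax (hΓ.le_of_ge hins (Set.subset_insert F Γ) (Set.mem_insert F Γ))

namespace IsMaxAvoiding

variable {α : Type} {Γ : Set (PropForm α)} {G A B : PropForm α}

theorem not_deriv_fals (h : IsMaxAvoiding G Γ) : ¬ Deriv Γ fals :=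
  fun hd => h.1 ((Deriv.falsElim G).mp hd)

theorem deriv_or (h : IsMaxAvoiding G Γ) (hAB : Deriv Γ (disj A B)) :
    Deriv Γ A ∨ Deriv Γ B := by
  by_contra! hn
  exact h.1 ((((Deriv.disjElim A B G).mp (h.2 A hn.1)).mp (h.2 B hn.2)).mp hAB)

theorem exists_of_bigDisj (h : IsMaxAvoiding G Γ) : ∀ {L : List (PropForm α)},
    Deriv Γ (bigDisj L) → ∃ A ∈ L, Deriv Γ A
  | [], hd => (h.not_deriv_fals hd).elim
  | [A], hd => ⟨A, by simp, hd⟩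
  | A :: B :: L, hd => by
    rcases h.deriv_or hd with hA | hL
    · exact ⟨A, by simp, hA⟩
    · obtain ⟨C, hC, hd⟩ := h.exists_of_bigDisj hL
      exact ⟨C, List.mem_cons_of_mem _ hC, hd⟩

/-- If the positive body literals of a general clause are derivable and the negated atoms
of its body lie outside `M`, then some head atom is derivable and lies in `M`. -/
theorem exists_mem_head {P : List (FClause α)} {M : Set α} (h : IsMaxAvoiding G Γ)
    (hΓ : fTh P ∪ negSet (fSig P \ M) ⊆ Γ) {c : FClause α} (hc : c ∈ P)
    (hGen : c.isGeneral) (hpos : ∀ a, (a, true) ∈ c.body → Deriv Γ (var a))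
    (hneg : ∀ a, (a, false) ∈ c.body → a ∉ M) :
    ∃ a, (a, true) ∈ c.head ∧ a ∈ M ∧ Deriv Γ (var a) := by
  have hnot : ∀ a ∈ fSig P, a ∉ M → Deriv Γ (neg (var a)) := fun a ha haM =>
    .ax (hΓ (Or.inr ⟨a, ⟨ha, haM⟩, rfl⟩))
  have hbody : Deriv Γ (bigConj (c.body.map litToProp)) := by
    rw [Deriv.bigConj_iff, List.forall_mem_map]
    rintro ⟨a, _ | _⟩ hl
    · exact hnot a ⟨c, hc, Or.inr ⟨_, hl⟩⟩ (hneg a hl)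
    · exact hpos a hl
  have hclause : Deriv Γ c.toProp := .ax (hΓ (Or.inl ⟨c, hc, rfl⟩))
  obtain ⟨A, hA, hd⟩ := h.exists_of_bigDisj (hclause.mp hbody)
  obtain ⟨⟨a, b⟩, hl, rfl⟩ := List.mem_map.1 hA
  obtain rfl : b = true := hGen _ hl
  refine ⟨a, hl, by_contra fun haM => ?_, hd⟩
  exact h.not_deriv_fals ((hnot a ⟨c, hc, Or.inl ⟨_, hl⟩⟩ haM).mp hd)

end IsMaxAvoiding

theorem g3_bigConj_le {α : Type} (I : α → Fin 3) : ∀ {L : List (PropForm α)},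
    ∀ F ∈ L, g3 I (bigConj L) ≤ g3 I F
  | [] => by simp
  | [A] => by simp [bigConj]
  | A :: B :: L => by
    rw [List.forall_mem_cons]
    exact ⟨min_le_left _ _, fun F hF => (min_le_right _ _).trans (g3_bigConj_le I F hF)⟩

theorem le_g3_bigDisj {α : Type} (I : α → Fin 3) : ∀ {L : List (PropForm α)},
    ∀ F ∈ L, g3 I F ≤ g3 I (bigDisj L)
  | [] => by simp
  | [A] => by simp [bigDisj]
  | A :: B :: L => by
    rw [List.forall_mem_cons]
    exact ⟨le_max_left _ _, fun F hF => (le_g3_bigDisj I F hF).trans (le_max_right _ _)⟩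

open scoped Classical in
/-- The here-and-there interpretation with `M` there and `M ∩ N` here. -/
noncomputable def htInterp {α : Type} (N M : Set α) (a : α) : Fin 3 :=
  if a ∈ M then if a ∈ N then 2 else 1 else 0

/-- If each of two theories avoiding some formula contains `P ∪ ¬M̃`, and one of them derives
every atom of `M`, then the atoms derivable from the other give a three-valued model of `P`. -/
theorem g3_htInterp_clause {α : Type} {P : List (FClause α)} {M : Set α}
    {Γ Δ : Set (PropForm α)} {F G : PropForm α}
    (hΓ : IsMaxAvoiding F Γ) (hPΓ : fTh P ∪ negSet (fSig P \ M) ⊆ Γ)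
    (hM : ∀ a ∈ M, Deriv Γ (var a))
    (hΔ : IsMaxAvoiding G Δ) (hPΔ : fTh P ∪ negSet (fSig P \ M) ⊆ Δ)
    {c : FClause α} (hc : c ∈ P) (hGen : c.isGeneral) :
    g3 (htInterp {a | Deriv Δ (var a)} M) c.toProp = 2 := by
  set I := htInterp {a | Deriv Δ (var a)} M with hI
  have hbody : ∀ l ∈ c.body, g3 I (bigConj (c.body.map litToProp)) ≤ g3 I (litToProp l) :=
    fun l hl => g3_bigConj_le I _ (List.mem_map_of_mem hl)
  have hhead : ∀ l ∈ c.head, g3 I (litToProp l) ≤ g3 I (bigDisj (c.head.map litToProp)) :=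
    fun l hl => le_g3_bigDisj I _ (List.mem_map_of_mem hl)
  simp only [FClause.toProp, g3, ite_eq_left_iff]
  refine fun hn => (hn ?_).elim
  generalize g3 I (bigConj (c.body.map litToProp)) = b at hbody ⊢
  generalize g3 I (bigDisj (c.head.map litToProp)) = d at hhead ⊢
  rcases eq_or_ne b 0 with rfl | hb
  · exact Fin.zero_le d
  have hneg : ∀ a, (a, false) ∈ c.body → a ∉ M := by
    intro a hl haM
    have := hbody _ hl
    by_cases haN : Deriv Δ (var a) <;>
      simp [litToProp, neg, g3, hI, htInterp, haM, haN] at this <;> exact hb this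
  have hposM : ∀ a, (a, true) ∈ c.body → a ∈ M := by
    intro a hl
    by_contra haM
    have := hbody _ hl
    simp [litToProp, g3, hI, htInterp, haM] at this
    exact hb this
  by_cases hb2 : b = 2
  · have hpos : ∀ a, (a, true) ∈ c.body → Deriv Δ (var a) := by
      intro a hl
      by_contra haN
      have := hbody _ hl
      simp [litToProp, g3, hI, htInterp, hposM a hl, haN, hb2] at this
    obtain ⟨a, hl, haM, haN⟩ := hΔ.exists_mem_head hPΔ hc hGen hpos hneg
    have := hhead _ hl
    simp only [litToProp, g3, hI, htInterp, haM, haN, Set.mem_ofPred_eq, if_true] at this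
    exact (Fin.le_last b).trans this
  · obtain ⟨a, hl, haM, -⟩ :=
      hΓ.exists_mem_head hPΓ hc hGen (fun a hl => hM a (hposM a hl)) hneg
    have := hhead _ hl
    by_cases haN : Deriv Δ (var a) <;>
      simp only [litToProp, g3, hI, htInterp, haM, haN, Set.mem_ofPred_eq, if_true, if_false]
        at this <;> omega

/-- for a general program `P` and `M ⊆ σ_P`,
`P ∪ ¬M̃ ⊩_I M` iff `P ∪ ¬M̃ ∪ ¬¬M ⊩_I M`. -/
theorem addNegNeg_iff {α : Type} (P : List (FClause α))
    (hGen : ∀ c ∈ P, c.isGeneral) (M : Set α) (hM : M ⊆ fSig P) :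
    IProvesAll (fTh P ∪ negSet (fSig P \ M)) M ↔
      IProvesAll (fTh P ∪ negSet (fSig P \ M) ∪ negnegSet M) M := by
  simp only [IProvesAll, IConsistent, iProves_iff_deriv]
  constructor
  · rintro ⟨hcons, hprov⟩
    refine ⟨fun h => hcons (h.cut ?_), fun a ha => (hprov a ha).mono Set.subset_union_left⟩
    rintro _ (hG | ⟨a, ha, rfl⟩)
    · exact .ax hG
    · exact Deriv.deduction
        (.mp (.ax (Set.mem_insert _ _)) ((hprov a ha).mono (Set.subset_insert _ _)))
  · rintro ⟨hcons, hprov⟩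
    refine ⟨fun h => hcons (h.mono Set.subset_union_left), fun a ha => by_contra fun hna => ?_⟩
    obtain ⟨Γ, hTΓ, hΓ⟩ := exists_isMaxAvoiding hcons
    obtain ⟨Δ, hTΔ, hΔ⟩ := exists_isMaxAvoiding hna
    have hmodel : g3 (htInterp {b | Deriv Δ (var b)} M) (var a) = 2 := by
      refine (hprov a ha).g3_eq_two ?_
      rintro _ ((⟨c, hc, rfl⟩ | ⟨b, hb, rfl⟩) | ⟨b, hb, rfl⟩)
      · exact g3_htInterp_clause hΓ (Set.subset_union_left.trans hTΓ)
          (fun b hb => (hprov b hb).mono hTΓ) hΔ hTΔ hc (hGen c hc)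
      · simp [neg, g3, htInterp, hb.2]
      · by_cases hbN : Deriv Δ (var b) <;> simp [neg, g3, htInterp, hb, hbN]
    have haN : ¬ Deriv Δ (var a) := hΔ.1
    simp [g3, htInterp, ha, haN] at hmodel

end ASP
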